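/- Let $p_1, p_2$ be coprime integers $\ge 2$ and let $q_2, q_3$ be coprime positive integers with $p_2 + 1 = (q_2+1)(q_3+1)$. Then $W = (p_2, p_1 q_2, p_1 q_3; p_1 p_2)$ is a reduced regular weight system, and its characteristic polynomial equals $\varphi_W(\lambda) = \frac{(\lambda^{p_1 p_2}-1)(\lambda^{p_1}-1)}{(\lambda^{p_2}-1)(\lambda-1)}$. -/

import Mathlib

open scoped BigOperators

/-- `χ_W(T) = T^{ε_W} ∏ᵢ (1 - T^{h - aᵢ})/(1 - T^{aᵢ})` for a weight system. -/
noncomputable def chiW (n : ℕ) (a : Fin n → ℕ) (h : ℕ) : RatFunc ℚ :=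
  (RatFunc.X : RatFunc ℚ) ^ ((∑ i, (a i : ℤ)) - (h : ℤ)) *
    ∏ i, (1 - (RatFunc.X : RatFunc ℚ) ^ (h - a i)) / (1 - (RatFunc.X : RatFunc ℚ) ^ (a i))

section RootProducts

open Polynomial

/-- If `μ` is a primitive `(n+1)`-st root of unity, then `P ^ (n+1) - 1` is the product of the
`P - μ ^ i` over `0 ≤ i ≤ n`; the factor with `i = 0` is split off. -/
lemma IsPrimitiveRoot.prod_sub_C_pow_succ_mul {R : Type*} [CommRing R] [IsDomain R] {n : ℕ} {μ : R}
    (hμ : IsPrimitiveRoot μ (n + 1)) (P : R[X]) :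
    (∏ i : Fin n, (P - C (μ ^ ((i : ℕ) + 1)))) * (P - 1) = P ^ (n + 1) - 1 := by
  have key := congrArg (fun Q : R[X] => Q.comp P)
    (X_pow_sub_C_eq_prod hμ n.succ_pos (one_pow (n + 1)))
  simp only [sub_comp, mul_comp, pow_comp, X_comp, C_comp, one_comp, mul_one, prod_comp,
    Finset.prod_range_succ', pow_zero, map_one] at key
  simpa [Finset.prod_range] using key.symm

/-- If `ζ` is a primitive `p`-th root of unity and `p + 1 = m * n`, then the exponents
`k + n * j` run through `0, …, p`, so every `p`-th root of `α ^ p` occurs once, except for `α`,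
which occurs twice. -/
lemma IsPrimitiveRoot.prod_prod_X_sub_C_pow_mul {R : Type*} [CommRing R] [IsDomain R]
    {p m n : ℕ} {ζ : R} (hζ : IsPrimitiveRoot ζ p) (hp : 0 < p) (hmn : p + 1 = m * n) (α : R) :
    ∏ j : Fin m, ∏ k : Fin n, (X - C (ζ ^ ((k : ℕ) + n * j) * α)) =
      (X ^ p - C (α ^ p)) * (X - C α) := by
  have key : ∏ x : Fin m × Fin n, (X - C (ζ ^ ((x.2 : ℕ) + n * x.1) * α)) =
      ∏ r : Fin (m * n), (X - C (ζ ^ (r : ℕ) * α)) :=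
    Fintype.prod_equiv finProdFinEquiv _ _ fun _ => rfl
  rw [← Fintype.prod_prod_type', key,
    ← Finset.prod_range fun r => X - C (ζ ^ r * α), ← hmn, Finset.prod_range_succ,
    ← X_pow_sub_C_eq_prod hζ hp rfl, hζ.pow_eq_one, one_mul]

end RootProducts

/-- If `a` divides `b`, then `(1 - T ^ b) / (1 - T ^ a)` is a finite geometric sum. -/
lemma RatFunc.one_sub_X_pow_div_eq_sum {K : Type*} [Field K] {a b m : ℕ} (ha : 0 < a)
    (hb : b = a * m) :
    (1 - (RatFunc.X : RatFunc K) ^ b) / (1 - (RatFunc.X : RatFunc K) ^ a) =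
      ∑ i : Fin m, (RatFunc.X : RatFunc K) ^ (a * (i : ℕ)) := by
  have hne : (RatFunc.X : RatFunc K) ^ a ≠ 1 := by
    rw [← RatFunc.algebraMap_X, ← map_pow, ← map_one (algebraMap (Polynomial K) (RatFunc K))]
    intro h
    have hd := congrArg Polynomial.natDegree (RatFunc.algebraMap_injective K h)
    simp only [Polynomial.natDegree_X_pow, Polynomial.natDegree_one] at hd
    omega
  simp only [pow_mul]
  rw [← Finset.sum_range fun i => ((RatFunc.X : RatFunc K) ^ a) ^ i, geom_sum_eq hne,
    ← neg_sub _ (1 : RatFunc K), ← neg_sub _ (1 : RatFunc K), neg_div_neg_eq, hb, pow_mul]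

/-- The exponents of the type III weight system with `p₁ = n + 1`, indexed by the monomials
spanning the Jacobian ring. -/
def typeIIIExponent (n p₂ q₂ q₃ : ℕ) (x : Fin n × Fin (q₂ + 1) × Fin (q₃ + 1)) : ℤ :=
  (p₂ + ((n + 1) * q₂ + (n + 1) * q₃) - (n + 1) * p₂ : ℤ) +
    ((p₂ * x.1 + ((n + 1) * q₃ * x.2.1 + (n + 1) * q₂ * x.2.2) : ℕ) : ℤ)

lemma chiW_typeIII_eq_sum {n p₂ q₂ q₃ : ℕ} (hp₂ : 0 < p₂) (hq₂ : 0 < q₂) (hq₃ : 0 < q₃)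
    (hfac : p₂ + 1 = (q₂ + 1) * (q₃ + 1)) :
    chiW 3 ![p₂, (n + 1) * q₂, (n + 1) * q₃] ((n + 1) * p₂) =
      ∑ x, (RatFunc.X : RatFunc ℚ) ^ typeIIIExponent n p₂ q₂ q₃ x := by
  have hp₂_eq : p₂ = q₂ * q₃ + q₂ + q₃ := by linarith
  have h₁ := RatFunc.one_sub_X_pow_div_eq_sum (K := ℚ) (b := (n + 1) * p₂ - p₂) (m := n) hp₂
    (Nat.sub_eq_of_eq_add (by ring))
  have h₂ := RatFunc.one_sub_X_pow_div_eq_sum (K := ℚ) (b := (n + 1) * p₂ - (n + 1) * q₂)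
    (m := q₂ + 1) (Nat.mul_pos (Nat.add_one_pos n) hq₃) (Nat.sub_eq_of_eq_add (by rw [hp₂_eq]; ring))
  have h₃ := RatFunc.one_sub_X_pow_div_eq_sum (K := ℚ) (b := (n + 1) * p₂ - (n + 1) * q₃)
    (m := q₃ + 1) (Nat.mul_pos (Nat.add_one_pos n) hq₂) (Nat.sub_eq_of_eq_add (by rw [hp₂_eq]; ring))
  have hX : (RatFunc.X : RatFunc ℚ) ≠ 0 := RatFunc.X_ne_zero
  simp only [chiW, Fin.sum_univ_three, Fin.prod_univ_three, Matrix.cons_val]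
  rw [h₁, mul_assoc (∑ i : Fin n, _), div_mul_div_comm, mul_comm (1 - RatFunc.X ^ ((n + 1) * q₂)),
    ← div_mul_div_comm, h₂, h₃, Fintype.sum_mul_sum, ← Fintype.sum_prod_type',
    Fintype.sum_mul_sum, ← Fintype.sum_prod_type', Finset.mul_sum]
  refine Finset.sum_congr rfl fun x _ => ?_
  rw [typeIIIExponent, zpow_add₀ hX, zpow_natCast, pow_add, pow_add]
  congr 2
  push_cast
  ring

lemma prod_typeIIIExponent_mul {n p₂ q₂ q₃ : ℕ} (hp₂ : 0 < p₂) (hq : Nat.Coprime q₂ q₃)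
    (hp : Nat.Coprime (n + 1) p₂) (hfac : p₂ + 1 = (q₂ + 1) * (q₃ + 1)) :
    (∏ x, (Polynomial.X - Polynomial.C (Complex.exp (2 * Real.pi * Complex.I *
        (typeIIIExponent n p₂ q₂ q₃ x : ℂ) / (((n + 1) * p₂ : ℕ) : ℂ))))) *
        ((Polynomial.X ^ p₂ - 1) * (Polynomial.X - 1)) =
      (Polynomial.X ^ ((n + 1) * p₂) - 1) * ((Polynomial.X ^ (n + 1) - 1) : Polynomial ℂ) := by
  have hp₂_eq : p₂ = q₂ * q₃ + q₂ + q₃ := by linarith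
  have hpos : 0 < (n + 1) * p₂ := Nat.mul_pos n.succ_pos hp₂
  obtain ⟨ω, hω_def⟩ : ∃ ω, ω = Complex.exp (2 * Real.pi * Complex.I / (((n + 1) * p₂ : ℕ) : ℂ)) :=
    ⟨_, rfl⟩
  have hω : IsPrimitiveRoot ω ((n + 1) * p₂) :=
    hω_def ▸ Complex.isPrimitiveRoot_exp _ hpos.ne'
  have hω₀ : ω ≠ 0 := hω.ne_zero hpos.ne'
  have hη : IsPrimitiveRoot (ω ^ p₂) (n + 1) := hω.pow hpos (mul_comm _ _)
  have hθ : IsPrimitiveRoot (ω ^ (n + 1)) p₂ := hω.pow hpos rfl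
  have hq₂p₂ : Nat.Coprime q₂ p₂ := by
    rw [hp₂_eq, show q₂ * q₃ + q₂ + q₃ = q₃ + q₂ * (q₃ + 1) by ring]
    simpa using hq
  have hζ := (hθ.pow_of_coprime q₂ hq₂p₂).inv
  have hroot (i : Fin n) (j : Fin (q₂ + 1)) (k : Fin (q₃ + 1)) :
      Complex.exp (2 * Real.pi * Complex.I *
        (typeIIIExponent n p₂ q₂ q₃ (i, j, k.rev) : ℂ) / (((n + 1) * p₂ : ℕ) : ℂ)) =
      ((ω ^ (n + 1)) ^ q₂)⁻¹ ^ ((k : ℕ) + (q₃ + 1) * j) * (ω ^ p₂) ^ ((i : ℕ) + 1) := by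
    have hexp : Complex.exp (2 * Real.pi * Complex.I *
        (typeIIIExponent n p₂ q₂ q₃ (i, j, k.rev) : ℂ) / (((n + 1) * p₂ : ℕ) : ℂ)) =
        ω ^ typeIIIExponent n p₂ q₂ q₃ (i, j, k.rev) := by
      rw [hω_def, ← Complex.exp_int_mul]
      congr 1
      ring
    have hk : ((k.rev : ℕ) : ℤ) = q₃ - k := by
      rw [Fin.val_rev]
      have := k.isLt
      omega
    rw [hexp, inv_pow, eq_inv_mul_iff_mul_eq₀ (by positivity), ← pow_mul, ← pow_mul, ← pow_mul,
      ← zpow_natCast, ← zpow_natCast, ← zpow_add₀ hω₀]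
    have hsplit : (((n + 1) * (q₂ * ((k : ℕ) + (q₃ + 1) * j)) : ℕ) : ℤ) +
        typeIIIExponent n p₂ q₂ q₃ (i, j, k.rev) =
        ((p₂ * ((i : ℕ) + 1) : ℕ) : ℤ) + (((n + 1) * p₂ : ℕ) : ℤ) * (j : ℕ) := by
      simp only [typeIIIExponent]
      push_cast
      rw [hk, show (p₂ : ℤ) = q₂ * q₃ + q₂ + q₃ by exact_mod_cast hp₂_eq]
      ring
    rw [hsplit, zpow_add₀ hω₀, zpow_mul, zpow_natCast ω ((n + 1) * p₂), hω.pow_eq_one, one_zpow,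
      mul_one]
  have hinner (i : Fin n) :
      ∏ y : Fin (q₂ + 1) × Fin (q₃ + 1), (Polynomial.X - Polynomial.C (Complex.exp
        (2 * Real.pi * Complex.I * (typeIIIExponent n p₂ q₂ q₃ (i, y) : ℂ) /
          (((n + 1) * p₂ : ℕ) : ℂ)))) =
      (Polynomial.X ^ p₂ - Polynomial.C (((ω ^ p₂) ^ p₂) ^ ((i : ℕ) + 1))) *
        (Polynomial.X - Polynomial.C ((ω ^ p₂) ^ ((i : ℕ) + 1))) := by
    rw [pow_right_comm (ω ^ p₂) p₂, ← hζ.prod_prod_X_sub_C_pow_mul hp₂ hfac,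
      Fintype.prod_prod_type]
    refine Finset.prod_congr rfl fun j _ => ?_
    rw [← Equiv.prod_comp Fin.revPerm]
    exact Finset.prod_congr rfl fun k _ => by rw [Fin.revPerm_apply, hroot]
  rw [Fintype.prod_prod_type, Finset.prod_congr rfl fun i _ => hinner i,
    Finset.prod_mul_distrib, mul_mul_mul_comm,
    (hη.pow_of_coprime p₂ hp.symm).prod_sub_C_pow_succ_mul, hη.prod_sub_C_pow_succ_mul, ← pow_mul,
    mul_comm p₂]

/-- The type III weight system `W = (p₂, p₁q₂, p₁q₃; p₁p₂)` is reduced and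
regular, with characteristic polynomial
`φ_W(λ) = (λ^{p₁p₂}-1)(λ^{p₁}-1) / ((λ^{p₂}-1)(λ-1))`. -/
theorem typeIII_char_poly (p₁ p₂ q₂ q₃ : ℕ)
    (hp₁ : 2 ≤ p₁) (hp₂ : 2 ≤ p₂)
    (hq₂ : 0 < q₂) (hq₃ : 0 < q₃) (hq : Nat.Coprime q₂ q₃)
    (hp : Nat.Coprime p₁ p₂) (hfac : p₂ + 1 = (q₂ + 1) * (q₃ + 1)) :
    Nat.gcd p₂ (Nat.gcd (p₁ * q₂) (Nat.gcd (p₁ * q₃) (p₁ * p₂))) = 1 ∧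
    ∃ (μ : ℕ) (ms : Fin μ → ℤ),
      chiW 3 ![p₂, p₁ * q₂, p₁ * q₃] (p₁ * p₂)
        = ∑ j, (RatFunc.X : RatFunc ℚ) ^ (ms j) ∧
      (∏ j, (Polynomial.X - Polynomial.C
          (Complex.exp (2 * Real.pi * Complex.I * (ms j : ℂ) / ((p₁ * p₂ : ℕ) : ℂ))))) *
        ((Polynomial.X ^ p₂ - 1) * (Polynomial.X - 1))
      = (Polynomial.X ^ (p₁ * p₂) - 1) * ((Polynomial.X ^ p₁ - 1) : Polynomial ℂ) := by
  refine ⟨?_, ?_⟩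
  · set g := Nat.gcd p₂ (Nat.gcd (p₁ * q₂) (Nat.gcd (p₁ * q₃) (p₁ * p₂)))
    have hg : g ∣ p₂ := Nat.gcd_dvd_left _ _
    have hg' : g ∣ Nat.gcd (p₁ * q₂) (Nat.gcd (p₁ * q₃) (p₁ * p₂)) := Nat.gcd_dvd_right _ _
    have hgp₁ : Nat.Coprime g p₁ := (hp.coprime_dvd_right hg).symm
    have hgq₂ : g ∣ q₂ := hgp₁.dvd_of_dvd_mul_left (hg'.trans (Nat.gcd_dvd_left _ _))
    have hgq₃ : g ∣ q₃ := hgp₁.dvd_of_dvd_mul_left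
      ((hg'.trans (Nat.gcd_dvd_right _ _)).trans (Nat.gcd_dvd_left _ _))
    exact Nat.eq_one_of_dvd_coprimes hq hgq₂ hgq₃
  · obtain ⟨n, rfl⟩ : ∃ n, p₁ = n + 1 := ⟨p₁ - 1, by omega⟩
    let e := (Fintype.equivFin (Fin n × Fin (q₂ + 1) × Fin (q₃ + 1))).symm
    refine ⟨_, fun j => typeIIIExponent n p₂ q₂ q₃ (e j), ?_, ?_⟩
    · rw [chiW_typeIII_eq_sum (by omega) hq₂ hq₃ hfac]
      exact (e.sum_comp _).symm
    · rw [← prod_typeIIIExponent_mul (by omega) hq hp hfac]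
      congr 1
      exact e.prod_comp fun x => Polynomial.X - Polynomial.C (Complex.exp
        (2 * Real.pi * Complex.I * (typeIIIExponent n p₂ q₂ q₃ x : ℂ) /
          (((n + 1) * p₂ : ℕ) : ℂ)))
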